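/- arXiv:1410.7978 — 2 statements merged into one kernel-verified Lean document; each statement's English description precedes it below -/
import Mathlib

section
/- (Gát's lemma) Let t, n ∈ ℕ with n > t and let x ∈ I_t \ I_{t+1} (so that x_t ≠ 0). If x − x_t·e_t ∉ I_n, then K_{M_n}(x) = 0; if x − x_t·e_t ∈ I_n, then K_{M_n}(x) = M_t / (1 − r_t(x)). (Here x_t·e_t denotes the element of G_m whose t-th coordinate is x_t and whose other coordinates are 0; note r_t(x) ≠ 1 since x_t ≠ 0.) -/
open MeasureTheory Finset

noncomputable section

namespace Vilenkin

instance (n : ℕ) : MeasurableSpace (ZMod n) := ⊤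

abbrev G (m : ℕ → ℕ) : Type := ∀ k, ZMod (m k)

def M (m : ℕ → ℕ) : ℕ → ℕ
  | 0 => 1
  | k + 1 => m k * M m k

def digit (m : ℕ → ℕ) (n k : ℕ) : ℕ := (n / M m k) % m k

def rad (m : ℕ → ℕ) (k : ℕ) (x : G m) : ℂ :=
  Complex.exp (2 * (Real.pi : ℂ) * Complex.I * ((x k).val : ℂ) / (m k : ℂ))

def psi (m : ℕ → ℕ) (n : ℕ) (x : G m) : ℂ :=
  ∏ k ∈ Finset.range (n + 1), rad m k x ^ digit m n k

def D (m : ℕ → ℕ) (n : ℕ) (x : G m) : ℂ := ∑ k ∈ Finset.range n, psi m k x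

def K (m : ℕ → ℕ) (n : ℕ) (x : G m) : ℂ := (n : ℂ)⁻¹ * ∑ k ∈ Finset.range n, D m k x

def cyl (m : ℕ → ℕ) (n : ℕ) (x : G m) : Set (G m) := {y | ∀ j < n, y j = x j}

def e (m : ℕ → ℕ) (k : ℕ) : G m := fun j => if j = k then 1 else 0

def lo (m : ℕ → ℕ) (n : ℕ) : ℕ := sInf {j | digit m n j ≠ 0}

def hi (m : ℕ → ℕ) (n : ℕ) : ℕ := sSup {j | digit m n j ≠ 0}

def Iij (m : ℕ → ℕ) (N i j : ℕ) : Set (G m) :=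
  if j = N then {x | x i ≠ 0 ∧ ∀ t < N, t ≠ i → x t = 0}
  else {x | (∀ t < i, x t = 0) ∧ x i ≠ 0 ∧ (∀ t, i < t → t < j → x t = 0) ∧ x j ≠ 0}

def IsVilenkinMeasure (m : ℕ → ℕ) (μ : Measure (G m)) : Prop :=
  IsProbabilityMeasure μ ∧ ∀ (n : ℕ) (x : G m), μ (cyl m n x) = (M m n : ENNReal)⁻¹

def fhat (m : ℕ → ℕ) (μ : Measure (G m)) (f : G m → ℂ) (k : ℕ) : ℂ :=
  ∫ x, f x * (starRingEnd ℂ) (psi m k x) ∂μ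

def S (m : ℕ → ℕ) (μ : Measure (G m)) (f : G m → ℂ) (n : ℕ) (x : G m) : ℂ :=
  ∑ k ∈ Finset.range n, fhat m μ f k * psi m k x

def sigma (m : ℕ → ℕ) (μ : Measure (G m)) (f : G m → ℂ) (n : ℕ) (x : G m) : ℂ :=
  (n : ℂ)⁻¹ * ∑ k ∈ Finset.range n, S m μ f k x

end Vilenkin

namespace Vilenkin

theorem aux_M_pos (m : ℕ → ℕ) (hm : ∀ k, 2 ≤ m k) (n : ℕ) : 0 < M m n := by
  induction n with
  | zero => simp [M]
  | succ k ih => exact Nat.mul_pos (by have := hm k; omega) ih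

theorem aux_lt_M (m : ℕ → ℕ) (hm : ∀ k, 2 ≤ m k) (n : ℕ) : n < M m n := by
  induction n with
  | zero => simp [M]
  | succ k ih =>
    have h : 2 * M m k ≤ m k * M m k := Nat.mul_le_mul_right _ (hm k)
    show k + 1 < m k * M m k
    omega

theorem aux_M_dvd (m : ℕ → ℕ) (k n : ℕ) (h : k ≤ n) : M m k ∣ M m n := by
  induction n, h using Nat.le_induction with
  | base => exact dvd_rfl
  | succ n _ ih => exact Dvd.dvd.mul_left ih (m n)

theorem aux_digit_zero (m : ℕ → ℕ) (hm : ∀ k, 2 ≤ m k) (n N k : ℕ) (h : n < M m N)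
    (hk : N ≤ k) : digit m n k = 0 := by
  have h1 := Nat.le_of_dvd (aux_M_pos m hm k) (aux_M_dvd m N k hk)
  simp [digit, Nat.div_eq_of_lt (lt_of_lt_of_le h h1)]

theorem aux_prod (m : ℕ → ℕ) (hm : ∀ k, 2 ≤ m k) (n N P : ℕ) (h : n < M m N)
    (hk : N ≤ P) (x : G m) : ∏ k ∈ Finset.range N, rad m k x ^ digit m n k =
      ∏ k ∈ Finset.range P, rad m k x ^ digit m n k := by
  apply Finset.prod_subset (Finset.range_subset_range.2 hk)
  intro k _ hk2
  rw [aux_digit_zero m hm n N k h (by simpa using hk2), pow_zero]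

theorem aux_psi (m : ℕ → ℕ) (hm : ∀ k, 2 ≤ m k) (n N : ℕ) (h : n < M m N) (x : G m) :
    psi m n x = ∏ k ∈ Finset.range N, rad m k x ^ digit m n k := by
  have h1 : n < M m (n + 1) := by have := aux_lt_M m hm (n + 1); omega
  rw [psi, aux_prod m hm n (n + 1) (max (n + 1) N) h1 (le_max_left _ _),
    aux_prod m hm n N (max (n + 1) N) h (le_max_right _ _)]

theorem aux_psi_add (m : ℕ → ℕ) (hm : ∀ k, 2 ≤ m k) (n a b : ℕ) (ha : a < m n)
    (hb : b < M m n) (x : G m) :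
    psi m (a * M m n + b) x = rad m n x ^ a * psi m b x := by
  have hM := aux_M_pos m hm n
  have h1 : a * M m n + b < M m (n + 1) := by
    show _ < m n * M m n
    have : (a + 1) * M m n ≤ m n * M m n := Nat.mul_le_mul_right _ ha
    rw [add_mul, one_mul] at this
    omega
  rw [aux_psi m hm _ _ h1, aux_psi m hm b n hb, Finset.prod_range_succ, mul_comm]
  congr 1
  · congr 1
    rw [digit, add_comm, Nat.add_mul_div_right _ _ hM, Nat.div_eq_of_lt hb, zero_add,
      Nat.mod_eq_of_lt ha]
  · apply Finset.prod_congr rfl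
    intro k hk
    congr 1
    obtain ⟨q, hq⟩ := aux_M_dvd m (k + 1) n (by simpa using hk)
    have hq' : M m n = m k * M m k * q := hq
    have hk0 := aux_M_pos m hm k
    rw [digit, digit, show a * M m n + b = b + (m k * (a * q)) * M m k by rw [hq']; ring,
      Nat.add_mul_div_right _ _ hk0, Nat.add_mul_mod_self_left]

theorem aux_sum (f : ℕ → ℂ) (a L : ℕ) : ∑ k ∈ Finset.range (a * L), f k =
    ∑ i ∈ Finset.range a, ∑ j ∈ Finset.range L, f (i * L + j) := by
  induction a with
  | zero => simp
  | succ a ih => rw [Finset.sum_range_succ, ← ih, add_mul, one_mul, Finset.sum_range_add]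

theorem aux_D_add (m : ℕ → ℕ) (hm : ∀ k, 2 ≤ m k) (n a b : ℕ) (ha : a < m n)
    (hb : b ≤ M m n) (x : G m) :
    D m (a * M m n + b) x =
      (∑ i ∈ Finset.range a, rad m n x ^ i) * D m (M m n) x + rad m n x ^ a * D m b x := by
  rw [D, Finset.sum_range_add, aux_sum, Finset.sum_mul, D, D, Finset.mul_sum]
  congr 1
  · apply Finset.sum_congr rfl
    intro i hi
    rw [Finset.mul_sum]
    apply Finset.sum_congr rfl
    intro j hj
    simp only [Finset.mem_range] at hi hj
    exact aux_psi_add m hm n i j (by omega) hj x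
  · apply Finset.sum_congr rfl
    intro j hj
    simp only [Finset.mem_range] at hj
    exact aux_psi_add m hm n a j ha (by omega) x

theorem aux_D_succ (m : ℕ → ℕ) (hm : ∀ k, 2 ≤ m k) (n : ℕ) (x : G m) :
    D m (M m (n + 1)) x = (∑ i ∈ Finset.range (m n), rad m n x ^ i) * D m (M m n) x := by
  show D m (m n * M m n) x = _
  rw [D, aux_sum, Finset.sum_mul, D]
  apply Finset.sum_congr rfl
  intro i hi
  rw [Finset.mul_sum]
  apply Finset.sum_congr rfl
  intro j hj
  simp only [Finset.mem_range] at hi hj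
  exact aux_psi_add m hm n i j (by omega) hj x

theorem aux_F_succ (m : ℕ → ℕ) (hm : ∀ k, 2 ≤ m k) (n : ℕ) (x : G m) :
    ∑ k ∈ Finset.range (M m (n + 1)), D m k x =
      (∑ a ∈ Finset.range (m n), ∑ i ∈ Finset.range a, rad m n x ^ i) *
        ((M m n : ℂ) * D m (M m n) x) +
      (∑ i ∈ Finset.range (m n), rad m n x ^ i) * ∑ k ∈ Finset.range (M m n), D m k x := by
  show ∑ k ∈ Finset.range (m n * M m n), D m k x = _
  rw [aux_sum, Finset.sum_mul, Finset.sum_mul, ← Finset.sum_add_distrib]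
  apply Finset.sum_congr rfl
  intro a ha
  simp only [Finset.mem_range] at ha
  rw [Finset.sum_congr rfl (fun j hj => aux_D_add m hm n a j ha
    (Finset.mem_range.1 hj).le x), Finset.sum_add_distrib, Finset.mul_sum]
  simp
  ring

theorem aux_rad_zero (m : ℕ → ℕ) (k : ℕ) (x : G m) (h : x k = 0) : rad m k x = 1 := by
  simp [rad, h]

theorem aux_rad_pow (m : ℕ → ℕ) (hm : ∀ k, 2 ≤ m k) (k : ℕ) (x : G m) :
    rad m k x ^ m k = 1 := by
  have h0 : (m k : ℂ) ≠ 0 := by have := hm k; exact_mod_cast (by omega : m k ≠ 0)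
  rw [rad, ← Complex.exp_nat_mul, Complex.exp_eq_one_iff]
  refine ⟨(x k).val, ?_⟩
  push_cast
  field_simp

theorem aux_rad_ne (m : ℕ → ℕ) (hm : ∀ k, 2 ≤ m k) (k : ℕ) (x : G m) (h : x k ≠ 0) :
    rad m k x ≠ 1 := by
  have h0 : m k ≠ 0 := by have := hm k; omega
  have : NeZero (m k) := ⟨h0⟩
  have hp := Complex.isPrimitiveRoot_exp (m k) h0
  have he : rad m k x = Complex.exp (2 * Real.pi * Complex.I / (m k)) ^ (x k).val := by
    rw [rad, ← Complex.exp_nat_mul]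
    congr 1
    ring
  rw [he]
  exact hp.pow_ne_one_of_pos_of_lt (by simpa [ZMod.val_eq_zero] using h) (ZMod.val_lt _)

theorem aux_s_ne (m : ℕ → ℕ) (hm : ∀ k, 2 ≤ m k) (k : ℕ) (x : G m) (h : x k ≠ 0) :
    ∑ i ∈ Finset.range (m k), rad m k x ^ i = 0 := by
  rw [geom_sum_eq (aux_rad_ne m hm k x h), aux_rad_pow m hm]
  simp

theorem aux_s_zero (m : ℕ → ℕ) (k : ℕ) (x : G m) (h : x k = 0) :
    ∑ i ∈ Finset.range (m k), rad m k x ^ i = m k := by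
  simp [aux_rad_zero m k x h]

theorem aux_ss (m : ℕ → ℕ) (hm : ∀ k, 2 ≤ m k) (k : ℕ) (x : G m) (h : x k ≠ 0) :
    ∑ a ∈ Finset.range (m k), ∑ i ∈ Finset.range a, rad m k x ^ i =
      m k / (1 - rad m k x) := by
  have h1 := aux_rad_ne m hm k x h
  have h2 : rad m k x - 1 ≠ 0 := sub_ne_zero.2 h1
  have h3 : 1 - rad m k x ≠ 0 := sub_ne_zero.2 h1.symm
  simp_rw [geom_sum_eq h1]
  rw [← Finset.sum_div, Finset.sum_sub_distrib, aux_s_ne m hm k x h]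
  simp
  rw [div_eq_div_iff h2 h3]
  ring

theorem aux_D_le (m : ℕ → ℕ) (hm : ∀ k, 2 ≤ m k) (n : ℕ) (x : G m)
    (h : ∀ j < n, x j = 0) : D m (M m n) x = M m n := by
  induction n with
  | zero => simp [D, M, psi, digit]
  | succ n ih =>
    rw [aux_D_succ m hm, ih (fun j hj => h j (by omega)), aux_s_zero m n x (h n (by omega))]
    simp [M]

theorem aux_D_gt (m : ℕ → ℕ) (hm : ∀ k, 2 ≤ m k) (t n : ℕ) (x : G m) (ht : x t ≠ 0)
    (h : t + 1 ≤ n) : D m (M m n) x = 0 := by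
  induction n, h using Nat.le_induction with
  | base => rw [aux_D_succ m hm, aux_s_ne m hm t x ht, zero_mul]
  | succ n _ ih => rw [aux_D_succ m hm, ih, mul_zero]

theorem aux_main (m : ℕ → ℕ) (hm : ∀ k, 2 ≤ m k) (t n : ℕ) (x : G m)
    (hx : ∀ j < t, x j = 0) (ht : x t ≠ 0) (h : t + 1 ≤ n) :
    ((∃ j, t < j ∧ j < n ∧ x j ≠ 0) → ∑ k ∈ Finset.range (M m n), D m k x = 0) ∧
    ((∀ j, t < j → j < n → x j = 0) → ∑ k ∈ Finset.range (M m n), D m k x =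
      M m n * (M m t / (1 - rad m t x))) := by
  induction n, h using Nat.le_induction with
  | base =>
    refine ⟨fun ⟨j, h1, h2, _⟩ => by omega, fun _ => ?_⟩
    rw [aux_F_succ m hm, aux_s_ne m hm t x ht, aux_ss m hm t x ht, aux_D_le m hm t x hx]
    simp only [M]
    push_cast
    ring
  | succ n hn ih =>
    rw [aux_F_succ m hm, aux_D_gt m hm t n x ht hn, mul_zero, mul_zero, zero_add]
    constructor
    · rintro ⟨j, h1, h2, h3⟩
      by_cases hj : j = n
      · subst hj
        rw [aux_s_ne m hm j x h3, zero_mul]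
      · rw [ih.1 ⟨j, h1, by omega, h3⟩, mul_zero]
    · intro h0
      rw [ih.2 (fun j h1 h2 => h0 j h1 (by omega)), aux_s_zero m n x (h0 n (by omega) (by omega))]
      simp only [M]
      push_cast
      ring

end Vilenkin

open Vilenkin

theorem statement3 (m : ℕ → ℕ) (hm : ∀ k, 2 ≤ m k) (t n : ℕ) (hn : t < n)
    (x : G m) (hx1 : x ∈ cyl m t 0) (hx2 : x ∉ cyl m (t + 1) 0) :
    (Function.update x t 0 ∉ cyl m n 0 → K m (M m n) x = 0) ∧
    (Function.update x t 0 ∈ cyl m n 0 → K m (M m n) x = (M m t : ℂ) / (1 - rad m t x)) := by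
  have hx : ∀ j < t, x j = 0 := hx1
  have ht : x t ≠ 0 := by
    intro h
    apply hx2
    intro j hj
    rcases Nat.lt_succ_iff_lt_or_eq.1 hj with h1 | h1
    · exact hx j h1
    · subst h1; exact h
  obtain ⟨hA, hB⟩ := aux_main m hm t n x hx ht hn
  have hM : (M m n : ℂ) ≠ 0 := by exact_mod_cast (aux_M_pos m hm n).ne'
  constructor
  · intro h
    rw [K, hA, mul_zero]
    by_contra hc
    push Not at hc
    apply h
    intro j hj
    by_cases hjt : j = t
    · subst hjt; simp
    · rw [Function.update_of_ne hjt]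
      rcases Nat.lt_or_gt_of_ne hjt with h1 | h1
      · exact hx j h1
      · exact hc j h1 hj
  · intro h
    rw [K, hB, inv_mul_cancel_left₀ hM]
    intro j h1 h2
    have := h j h2
    rwa [Function.update_of_ne (by omega)] at this
end
end

section
/- Let t, n ∈ ℕ with n > t, let s be an integer with 1 ≤ s ≤ m_n − 1, and let x ∈ I_t \ I_{t+1} (so x_t ≠ 0). If x − x_t·e_t ∉ I_n, then K_{s M_n}(x) = 0. (Here x_t·e_t denotes the element of G_m whose t-th coordinate is x_t and whose other coordinates are 0.) -/
open MeasureTheory Finset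

noncomputable section

open Vilenkin

namespace Vilenkin

lemma M_dvd (m : ℕ → ℕ) {l k : ℕ} (h : l ≤ k) : M m l ∣ M m k := by
  induction k, h using Nat.le_induction with
  | base => exact dvd_rfl
  | succ k _ ih => exact ih.trans (Dvd.intro_left _ rfl)

lemma M_pos {m : ℕ → ℕ} (hm : ∀ k, 2 ≤ m k) (k : ℕ) : 0 < M m k := by
  induction k with
  | zero => exact Nat.one_pos
  | succ k ih => exact Nat.mul_pos (by have := hm k; omega) ih

lemma lt_M {m : ℕ → ℕ} (hm : ∀ k, 2 ≤ m k) (k : ℕ) : k < M m k := by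
  induction k with
  | zero => exact Nat.one_pos
  | succ k ih =>
    have h := Nat.mul_le_mul_right (M m k) (hm k)
    change k + 1 < m k * M m k
    omega

lemma digit_of_lt {m : ℕ → ℕ} {b l : ℕ} (h : b < M m l) : digit m b l = 0 := by
  simp [digit, Nat.div_eq_of_lt h]

lemma digit_add_low {m : ℕ → ℕ} (hm : ∀ k, 2 ≤ m k) (j b : ℕ) {k l : ℕ} (h : l < k) :
    digit m (j * M m k + b) l = digit m b l := by
  obtain ⟨c, hc⟩ := M_dvd m (Nat.succ_le_of_lt h)
  have hc' : j * M m k + b = b + M m l * (m l * (c * j)) := by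
    rw [hc]; change j * (m l * M m l * c) + b = _; ring
  rw [digit, digit, hc', Nat.add_mul_div_left _ _ (M_pos hm l), Nat.add_mul_mod_self_left]

lemma digit_add_high {m : ℕ → ℕ} (hm : ∀ k, 2 ≤ m k) (j : ℕ) {b k l : ℕ} (h : k ≤ l)
    (hb : b < M m k) :
    digit m (j * M m k + b) l = digit m (j * M m k) l := by
  obtain ⟨c, hc⟩ := M_dvd m h
  rw [digit, digit, hc, ← Nat.div_div_eq_div_mul, ← Nat.div_div_eq_div_mul, mul_comm j,
    Nat.mul_add_div (M_pos hm k), Nat.div_eq_of_lt hb, Nat.mul_div_cancel_left _ (M_pos hm k),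
    add_zero]

lemma psi_eq {m : ℕ → ℕ} (hm : ∀ k, 2 ≤ m k) (x : G m) {a N : ℕ} (h : a + 1 ≤ N) :
    psi m a x = ∏ k ∈ Finset.range N, rad m k x ^ digit m a k := by
  refine Finset.prod_subset (Finset.range_mono h) ?_
  intro k _ hk
  have hk' : a < k := by simpa using hk
  rw [digit_of_lt (hk'.trans (lt_M hm k)), pow_zero]

lemma psi_add {m : ℕ → ℕ} (hm : ∀ k, 2 ≤ m k) (x : G m) (j : ℕ) {b k : ℕ} (hb : b < M m k) :
    psi m (j * M m k + b) x = psi m (j * M m k) x * psi m b x := by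
  have h1 : j * M m k + 1 ≤ j * M m k + b + 1 := by omega
  have h2 : b + 1 ≤ j * M m k + b + 1 := by omega
  rw [psi_eq hm x le_rfl, psi_eq hm x h1, psi_eq hm x h2, ← Finset.prod_mul_distrib]
  refine Finset.prod_congr rfl fun l _ => ?_
  rw [← pow_add]
  congr 1
  rcases lt_or_ge l k with h | h
  · have h0 : digit m (j * M m k) l = 0 := by
      have := digit_add_low hm j 0 h
      rw [add_zero] at this
      rw [this]; simp [digit]
    rw [digit_add_low hm j b h, h0, zero_add]
  · rw [digit_add_high hm j h hb, digit_of_lt (hb.trans_le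
      (Nat.le_of_dvd (M_pos hm l) (M_dvd m h))), add_zero]

lemma psi_mul {m : ℕ → ℕ} (hm : ∀ k, 2 ≤ m k) (x : G m) {i u : ℕ} (hi : i < m u) :
    psi m (i * M m u) x = rad m u x ^ i := by
  have hN : i * M m u + 1 ≤ i * M m u + 1 + u + 1 := by omega
  rw [psi_eq hm x hN, Finset.prod_eq_single u]
  · rw [digit, Nat.mul_div_cancel _ (M_pos hm u), Nat.mod_eq_of_lt hi]
  · intro l _ hl
    rcases lt_or_gt_of_ne hl with h | h
    · have := digit_add_low hm i 0 h
      rw [add_zero] at this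
      rw [this]; simp [digit]
    · have h1 : i * M m u < M m (u + 1) := Nat.mul_lt_mul_of_pos_right hi (M_pos hm u)
      rw [digit_of_lt (h1.trans_le (Nat.le_of_dvd (M_pos hm l) (M_dvd m h))), pow_zero]
  · intro h
    exact absurd (Finset.mem_range.2 (by omega)) h

lemma geom_rad {m : ℕ → ℕ} (hm : ∀ k, 2 ≤ m k) (x : G m) {u : ℕ} (hx : x u ≠ 0) :
    ∑ i ∈ Finset.range (m u), psi m (i * M m u) x = 0 := by
  have h0 : m u ≠ 0 := by have := hm u; omega
  have : NeZero (m u) := ⟨h0⟩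
  have hp := Complex.isPrimitiveRoot_exp (m u) h0
  have hr : rad m u x = Complex.exp (2 * Real.pi * Complex.I / (m u)) ^ (x u).val := by
    rw [rad, ← Complex.exp_nat_mul]
    congr 1
    ring
  have h1 : rad m u x ≠ 1 := by
    rw [hr]
    exact hp.pow_ne_one_of_pos_of_lt (by simpa [ZMod.val_eq_zero] using hx) (ZMod.val_lt _)
  have h2 : rad m u x ^ m u = 1 := by
    rw [hr, pow_right_comm, hp.pow_eq_one, one_pow]
  rw [Finset.sum_congr rfl fun i hi => psi_mul hm x (Finset.mem_range.1 hi),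
    geom_sum_eq h1, h2, sub_self, zero_div]

lemma D_add {m : ℕ → ℕ} (hm : ∀ k, 2 ≤ m k) (x : G m) (j : ℕ) {b k : ℕ} (hb : b ≤ M m k) :
    D m (j * M m k + b) x = D m (j * M m k) x + psi m (j * M m k) x * D m b x := by
  rw [D, Finset.sum_range_add, D, D, Finset.mul_sum]
  congr 1
  exact Finset.sum_congr rfl fun i hi =>
    psi_add hm x j ((Finset.mem_range.1 hi).trans_le hb)

lemma D_mul {m : ℕ → ℕ} (hm : ∀ k, 2 ≤ m k) (x : G m) (j k : ℕ) :
    D m (j * M m k) x = (∑ i ∈ Finset.range j, psi m (i * M m k) x) * D m (M m k) x := by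
  induction j with
  | zero => simp [D]
  | succ j ih =>
    rw [Nat.succ_mul, D_add hm x j le_rfl, ih, Finset.sum_range_succ, add_mul]

lemma F_mul {m : ℕ → ℕ} (hm : ∀ k, 2 ≤ m k) (x : G m) (j : ℕ) {k : ℕ}
    (hD : D m (M m k) x = 0) :
    ∑ a ∈ Finset.range (j * M m k), D m a x =
      (∑ i ∈ Finset.range j, psi m (i * M m k) x) * ∑ a ∈ Finset.range (M m k), D m a x := by
  induction j with
  | zero => simp
  | succ j ih =>
    rw [Nat.succ_mul, Finset.sum_range_add, ih, Finset.sum_range_succ, add_mul]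
    congr 1
    rw [Finset.mul_sum]
    refine Finset.sum_congr rfl fun i hi => ?_
    rw [D_add hm x j (Finset.mem_range.1 hi).le, D_mul hm, hD, mul_zero, zero_add]

end Vilenkin

theorem statement7 (m : ℕ → ℕ) (hm : ∀ k, 2 ≤ m k) (t n : ℕ) (hn : t < n)
    (s : ℕ) (hs1 : 1 ≤ s) (hs2 : s ≤ m n - 1)
    (x : G m) (hx1 : x ∈ cyl m t 0) (hx2 : x ∉ cyl m (t + 1) 0)
    (hxe : Function.update x t 0 ∉ cyl m n 0) :
    K m (s * M m n) x = 0 := by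
  have hxt : x t ≠ 0 := by
    intro h
    apply hx2
    intro j hj
    rcases Nat.lt_succ_iff_lt_or_eq.1 hj with h' | rfl
    · exact hx1 j h'
    · exact h
  obtain ⟨u, hun, hut, hxu⟩ : ∃ u, u < n ∧ t < u ∧ x u ≠ 0 := by
    by_contra! hcon
    apply hxe
    intro j hj
    rcases lt_trichotomy j t with h | rfl | h
    · rw [Function.update_of_ne h.ne]; exact hx1 j h
    · simp
    · rw [Function.update_of_ne h.ne']; exact hcon j hj h
  have hD : ∀ k, t + 1 ≤ k → D m (M m k) x = 0 := by
    intro k hk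
    induction k, hk using Nat.le_induction with
    | base =>
      change D m (m t * M m t) x = 0
      rw [D_mul hm, geom_rad hm x hxt, zero_mul]
    | succ k _ ih =>
      change D m (m k * M m k) x = 0
      rw [D_mul hm, ih, mul_zero]
  have hF : ∀ k, u + 1 ≤ k → ∑ a ∈ Finset.range (M m k), D m a x = 0 := by
    intro k hk
    induction k, hk using Nat.le_induction with
    | base =>
      change ∑ a ∈ Finset.range (m u * M m u), D m a x = 0
      rw [F_mul hm x _ (hD u hut), geom_rad hm x hxu, zero_mul]
    | succ k hk ih =>
      change ∑ a ∈ Finset.range (m k * M m k), D m a x = 0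
      rw [F_mul hm x _ (hD k (by omega)), ih, mul_zero]
  rw [K, F_mul hm x _ (hD n hn), hF n hun, mul_zero, mul_zero]
end
end
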